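/- arXiv:1703.05441 — 2 statements merged into one kernel-verified Lean document; each statement's English description precedes it below -/
import Mathlib

section
/- Let A and B be N×N Hermitian complex matrices with B negative definite, let 1 ≤ m ≤ n < N, assume λ_n{A+B} < λ_{n+1}{A+B} and λ_m{A+B} < λ_{m+1}{A+B}, let P and P_m be the (unique) bottom-n and bottom-m eigenprojectors of A+B respectively, and set Δ_m := λ_{n+1}{A+B} − λ_m{A+B}. Let (P^(k))_{k≥0} be a sequence of rank-n orthogonal projectors such that, for each k ≥ 0, P^(k+1) is a bottom-n eigenprojector of A+B̃[P^(k)], and suppose P^(k) → P as k → ∞. For each k ≥ 1 let P_m^(k) be a bottom-m eigenprojector of A+B̃[P^(k−1)]. Then P_m^(k) → P_m, and for every ρ with ‖B‖₂/(‖B‖₂ + Δ_m) < ρ < 1 there exists a constant C > 0 such that ‖P_m^(k) − P_m‖₂ ≤ C·ρ^k·‖P^(0) − P‖₂ for all k ≥ 1. -/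
open Matrix
open scoped ComplexOrder

/-- The `i`-th smallest eigenvalue (1-indexed, counted with multiplicity) of a
Hermitian matrix `H`; junk value `0` otherwise. -/
noncomputable def eig {N : ℕ} (H : Matrix (Fin N) (Fin N) ℂ) (i : ℕ) : ℝ :=
  if hH : H.IsHermitian then
    if hi : i - 1 < N then hH.eigenvalues (Tuple.sort hH.eigenvalues ⟨i - 1, hi⟩) else 0
  else 0

/-- The adaptive compression `B̃[Q] = B (QBQ + (I-Q))⁻¹ B - B (I-Q) B`. -/
noncomputable def acomp {N : ℕ} (B Q : Matrix (Fin N) (Fin N) ℂ) : Matrix (Fin N) (Fin N) ℂ :=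
  B * (Q * B * Q + (1 - Q))⁻¹ * B - B * (1 - Q) * B

/-- `Q` is a rank-`n` orthogonal projector (Hermitian, idempotent, rank `n`). -/
def IsProjOfRank {N : ℕ} (n : ℕ) (Q : Matrix (Fin N) (Fin N) ℂ) : Prop :=
  Q.IsHermitian ∧ Q * Q = Q ∧ Q.rank = n

/-- `R` is a bottom-`n` eigenprojector of the Hermitian matrix `H`: a rank-`n`
orthogonal projector commuting with `H` whose range lies in the span of eigenvectors
for the `n` smallest eigenvalues, i.e. `x*Hx ≤ λ_n{H}·x*x` on the range of `R`. -/
def IsBottomEigenproj {N : ℕ} (n : ℕ) (H R : Matrix (Fin N) (Fin N) ℂ) : Prop :=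
  IsProjOfRank n R ∧ H * R = R * H ∧
    ∀ x : Fin N → ℂ, (∃ y, x = R.mulVec y) →
      (star x ⬝ᵥ H.mulVec x).re ≤ eig H n * (star x ⬝ᵥ x).re

/-- The spectral (operator) norm of a complex matrix: the operator norm of the
associated linear map on Euclidean space. -/
noncomputable def specNorm {N : ℕ} (M : Matrix (Fin N) (Fin N) ℂ) : ℝ :=
  ‖LinearMap.toContinuousLinearMap (Matrix.toEuclideanLin M)‖

section Operators

open RCLike ContinuousLinearMap Module

variable {𝕜 E : Type*} [RCLike 𝕜] [NormedAddCommGroup E] [InnerProductSpace 𝕜 E]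

/-- A star projection is symmetric. -/
lemma IsStarProjection.inner_apply_left [CompleteSpace E] {R : E →L[𝕜] E}
    (hR : IsStarProjection R) (x y : E) : inner 𝕜 (R x) y = inner 𝕜 x (R y) :=
  hR.isSelfAdjoint.isSymmetric x y

lemma IsStarProjection.apply_apply [CompleteSpace E] {R : E →L[𝕜] E}
    (hR : IsStarProjection R) (x : E) : R (R x) = R x :=
  DFunLike.congr_fun hR.isIdempotentElem.eq x

lemma Commute.clm_apply {T R : E →L[𝕜] E} (h : Commute T R) (x : E) : T (R x) = R (T x) :=
  DFunLike.congr_fun h.eq x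

lemma abs_reApplyInnerSelf_le (T : E →L[𝕜] E) (x : E) :
    |T.reApplyInnerSelf x| ≤ ‖T‖ * ‖x‖ ^ 2 := by
  rw [reApplyInnerSelf_apply]
  calc |re (inner 𝕜 (T x) x)| ≤ ‖T x‖ * ‖x‖ := (abs_re_le_norm _).trans (norm_inner_le_norm _ _)
    _ ≤ ‖T‖ * ‖x‖ * ‖x‖ := by gcongr; exact T.le_opNorm x
    _ = ‖T‖ * ‖x‖ ^ 2 := by ring

lemma reApplyInnerSelf_add (S T : E →L[𝕜] E) (x : E) :
    (S + T).reApplyInnerSelf x = S.reApplyInnerSelf x + T.reApplyInnerSelf x := by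
  simp [reApplyInnerSelf_apply, inner_add_left]

lemma reApplyInnerSelf_sub (S T : E →L[𝕜] E) (x : E) :
    (S - T).reApplyInnerSelf x = S.reApplyInnerSelf x - T.reApplyInnerSelf x := by
  simp [reApplyInnerSelf_apply, inner_sub_left]

/-- If `T ≥ H` is at most `c' < c` on the range of a projection `R` commuting with `T`, and every
subspace of dimension larger than `rank R` meets `{H ≥ c}`, then `T ≥ c` on the complement. -/
lemma le_reApplyInnerSelf_compl [FiniteDimensional 𝕜 E] [CompleteSpace E] {H T R : E →L[𝕜] E}
    {c c' : ℝ}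
    (hR : IsStarProjection R) (hTR : Commute T R)
    (hHT : ∀ x, H.reApplyInnerSelf x ≤ T.reApplyInnerSelf x)
    (hle : ∀ x, T.reApplyInnerSelf (R x) ≤ c' * ‖R x‖ ^ 2) (hc : c' < c)
    (hH : ∀ U : Submodule 𝕜 E, finrank 𝕜 (R : E →ₗ[𝕜] E).range < finrank 𝕜 U →
      ∃ z ∈ U, z ≠ 0 ∧ c * ‖z‖ ^ 2 ≤ H.reApplyInnerSelf z) (x : E) :
    c * ‖x - R x‖ ^ 2 ≤ T.reApplyInnerSelf (x - R x) := by
  by_contra! hlt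
  set u := x - R x with hu
  have hRu : R u = 0 := by simp [hu, hR.apply_apply]
  have hu0 : u ≠ 0 := by
    intro h
    simp [h, reApplyInnerSelf_apply] at hlt
  set U : Submodule 𝕜 E := (R : E →ₗ[𝕜] E).range ⊔ Submodule.span 𝕜 {u} with hU
  have hlt' : (R : E →ₗ[𝕜] E).range < U := by
    refine lt_of_le_of_ne le_sup_left fun h => hu0 ?_
    have : u ∈ (R : E →ₗ[𝕜] E).range := by
      rw [h]
      exact Submodule.mem_sup_right (Submodule.mem_span_singleton_self u)
    obtain ⟨w, hw⟩ := this
    have hw' : R w = u := hw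
    rw [← hw', ← hR.apply_apply, hw', hRu]
  obtain ⟨z, hzU, hz0, hz⟩ := hH U (Submodule.finrank_lt_finrank_of_lt hlt')
  obtain ⟨a, ⟨w, hw⟩, b, hb, rfl⟩ := Submodule.mem_sup.1 hzU
  obtain ⟨t, rfl⟩ := Submodule.mem_span_singleton.1 hb
  have hw' : R w = a := hw
  subst hw'
  have c1 : inner 𝕜 (R w) u = 0 := by rw [hR.inner_apply_left, hRu, inner_zero_right]
  have c2 : inner 𝕜 (T (R w)) u = 0 := by
    rw [hTR.clm_apply, hR.inner_apply_left, hRu, inner_zero_right]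
  have c3 : inner 𝕜 (T u) (R w) = 0 := by
    rw [← hR.inner_apply_left, ← hTR.clm_apply, hRu, map_zero, inner_zero_left]
  have e1 : ‖R w + t • u‖ ^ 2 = ‖R w‖ ^ 2 + ‖t‖ ^ 2 * ‖u‖ ^ 2 := by
    rw [norm_add_sq (𝕜 := 𝕜), inner_smul_right, c1, norm_smul]
    simp [mul_pow]
  have e2 : T.reApplyInnerSelf (R w + t • u) =
      T.reApplyInnerSelf (R w) + ‖t‖ ^ 2 * T.reApplyInnerSelf u := by
    rw [← reApplyInnerSelf_smul]
    simp only [reApplyInnerSelf_apply, map_add, map_smul, inner_add_left, inner_add_right,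
      inner_smul_left, inner_smul_right, c2, c3]
    simp
  have hz2 := hz.trans (hHT _)
  rw [e1, e2] at hz2
  have h3 := hle w
  have h4 : ‖t‖ ^ 2 * (c * ‖u‖ ^ 2 - T.reApplyInnerSelf u) ≤ (c' - c) * ‖R w‖ ^ 2 := by
    nlinarith
  have h5 : (c - c') * ‖R w‖ ^ 2 ≤ 0 := by
    have : 0 ≤ ‖t‖ ^ 2 * (c * ‖u‖ ^ 2 - T.reApplyInnerSelf u) :=
      mul_nonneg (sq_nonneg _) (sub_nonneg.2 hlt.le)
    linarith
  have h6 : R w = 0 := by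
    have h7 : ‖R w‖ ^ 2 ≤ 0 := nonpos_of_mul_nonpos_right h5 (sub_pos.2 hc)
    exact norm_eq_zero.1 (pow_eq_zero_iff two_ne_zero |>.1 (le_antisymm h7 (sq_nonneg _)))
  have h8 : ‖t‖ ^ 2 ≤ 0 := by
    rw [h6, norm_zero] at h4
    exact nonpos_of_mul_nonpos_left (by linarith) (sub_pos.2 hlt)
  have h9 : t = 0 :=
    norm_eq_zero.1 (pow_eq_zero_iff two_ne_zero |>.1 (le_antisymm h8 (sq_nonneg _)))
  exact hz0 (by rw [h6, h9]; simp)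

/-- The component of `v` in an invariant subspace obeys the same inhomogeneous eigenvalue
equation, tested against itself. -/
lemma reApplyInnerSelf_compl_eq [CompleteSpace E] {T R : E →L[𝕜] E} (hR : IsStarProjection R)
    (hTR : Commute T R) {v w : E} {μ : ℝ} (hv : T v = (μ : 𝕜) • v + w) :
    T.reApplyInnerSelf (v - R v) = μ * ‖v - R v‖ ^ 2 + re (inner 𝕜 w (v - R v)) := by
  have hRu : R (v - R v) = 0 := by simp [hR.apply_apply]
  have h1 : T (v - R v) = (μ : 𝕜) • (v - R v) + (w - R w) := by
    rw [map_sub, hTR.clm_apply, hv]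
    simp only [map_add, map_smul, smul_sub]
    abel
  rw [reApplyInnerSelf_apply, h1, inner_add_left, inner_sub_left, hR.inner_apply_left w, hRu,
    inner_zero_right, sub_zero, map_add, inner_smul_left, conj_ofReal, re_ofReal_mul,
    inner_self_eq_norm_sq]

lemma norm_compl_le_of_residual [CompleteSpace E] {T R : E →L[𝕜] E} (hR : IsStarProjection R)
    (hTR : Commute T R) {v w : E} {μ c : ℝ} (hv : T v = (μ : 𝕜) • v + w)
    (hc : c * ‖v - R v‖ ^ 2 ≤ T.reApplyInnerSelf (v - R v)) :
    (c - μ) * ‖v - R v‖ ≤ ‖w‖ := by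
  have h1 := reApplyInnerSelf_compl_eq hR hTR hv
  have h2 : re (inner 𝕜 w (v - R v)) ≤ ‖w‖ * ‖v - R v‖ := re_inner_le_norm _ _
  rcases (norm_nonneg (v - R v)).eq_or_lt with h | h
  · rw [← h, mul_zero]; exact norm_nonneg _
  · refine le_of_mul_le_mul_right ?_ h
    nlinarith

/-- One step of the iteration contracts the energy `⟨x, W₀ x⟩ + η ‖x‖²` of the component of an
eigenvector of `H` outside the current subspace. -/
lemma energy_compl_le [CompleteSpace E] {H W W₀ R : E →L[𝕜] E} (hR : IsStarProjection R)
    (hTR : Commute (H + W) R) {v y : E} {μ a β η ρ : ℝ} (hv : H v = (μ : 𝕜) • v) (hy : W v = W y)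
    (ha : a * ‖v - R v‖ ^ 2 ≤ H.reApplyInnerSelf (v - R v)) (hW : ‖W - W₀‖ ≤ η)
    (hsymm : (W₀ : E →ₗ[𝕜] E).IsSymmetric) (hnn : ∀ x, 0 ≤ W₀.reApplyInnerSelf x)
    (hβ : ∀ x, W₀.reApplyInnerSelf x ≤ β * ‖x‖ ^ 2) (hβ0 : 0 ≤ β) (hη : 0 < η)
    (hgap : η ≤ a - η - μ) (hρ0 : 0 < ρ) (hρ : β + η ≤ ρ * (β + (a - η - μ))) :
    W₀.reApplyInnerSelf (v - R v) + η * ‖v - R v‖ ^ 2 ≤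
      ρ ^ 2 * (W₀.reApplyInnerSelf y + η * ‖y‖ ^ 2) := by
  have h1 := reApplyInnerSelf_compl_eq (w := W y) hR hTR (by rw [_root_.add_apply, hv, hy])
  set u := v - R v
  have hd (x : E) : ‖(W - W₀) x‖ ≤ η * ‖x‖ := (W - W₀).le_of_opNorm_le hW x
  have h2 : W₀.reApplyInnerSelf u - η * ‖u‖ ^ 2 ≤ W.reApplyInnerSelf u := by
    have := (abs_le.1 (abs_reApplyInnerSelf_le (W - W₀) u)).1
    rw [reApplyInnerSelf_sub] at this
    nlinarith [mul_le_mul_of_nonneg_right hW (sq_nonneg ‖u‖)]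
  have h3 : re (inner 𝕜 (W y) u) ≤ re (inner 𝕜 (W₀ y) u) + η * ‖y‖ * ‖u‖ := by
    have : re (inner 𝕜 ((W - W₀) y) u) ≤ η * ‖y‖ * ‖u‖ :=
      (re_inner_le_norm _ _).trans (mul_le_mul_of_nonneg_right (hd y) (norm_nonneg _))
    rw [_root_.sub_apply, inner_sub_left, map_sub] at this
    linarith
  have h4 : 2 * ρ * re (inner 𝕜 (W₀ y) u) ≤
      W₀.reApplyInnerSelf u + ρ ^ 2 * W₀.reApplyInnerSelf y := by
    have h := hnn (u - (ρ : 𝕜) • y)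
    have hs : re (inner 𝕜 (W₀ u) y) = re (inner 𝕜 (W₀ y) u) := by
      rw [← inner_re_symm]
      exact congrArg re (hsymm y u).symm
    simp only [reApplyInnerSelf_apply, map_sub, map_smul, inner_sub_left, inner_sub_right,
      inner_smul_left, inner_smul_right, conj_ofReal, re_ofReal_mul, hs] at h ⊢
    nlinarith
  have h5 := sq_nonneg (‖u‖ - ρ * ‖y‖)
  rw [reApplyInnerSelf_add] at h1
  have hwn := hnn u
  have hwβ := hβ u
  set X := W₀.reApplyInnerSelf u + (a - η - μ) * ‖u‖ ^ 2 with hX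
  have hXle : X ≤ re (inner 𝕜 (W₀ y) u) + η * ‖y‖ * ‖u‖ := by rw [hX]; linarith
  have hX0 : 0 ≤ X := by
    have : 0 ≤ (a - η - μ) * ‖u‖ ^ 2 := mul_nonneg (by linarith) (sq_nonneg _)
    linarith
  have hE : W₀.reApplyInnerSelf u + η * ‖u‖ ^ 2 ≤ ρ * X := by
    have hpos : 0 < β + (a - η - μ) := by linarith
    refine le_of_mul_le_mul_right ?_ hpos
    have k1 : 0 ≤ (a - η - μ - η) * (β * ‖u‖ ^ 2 - W₀.reApplyInnerSelf u) :=
      mul_nonneg (by linarith) (by linarith)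
    have k2 := mul_le_mul_of_nonneg_left hρ hX0
    rw [hX] at k2 ⊢
    nlinarith
  have hm := mul_le_mul_of_nonneg_left hXle hρ0.le
  nlinarith

/-- Two projections of equal rank are close as soon as one complement nearly annihilates the range
of the other. -/
lemma norm_sub_le_of_finrank_range_eq [FiniteDimensional 𝕜 E] [CompleteSpace E] {ι : Type*}
    [Fintype ι] (b : OrthonormalBasis ι 𝕜 E) {R P : E →L[𝕜] E} (hR : IsStarProjection R)
    (hP : IsStarProjection P)
    (hrank : finrank 𝕜 (R : E →ₗ[𝕜] E).range = finrank 𝕜 (P : E →ₗ[𝕜] E).range) :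
    ‖R - P‖ ≤ Fintype.card ι * (2 * ∑ i, ‖P (b i) - R (P (b i))‖) := by
  have htr {S : E →L[𝕜] E} (hS : IsStarProjection S) :
      LinearMap.trace 𝕜 E (S : E →ₗ[𝕜] E) = (finrank 𝕜 (S : E →ₗ[𝕜] E).range : 𝕜) :=
    LinearMap.IsProj.trace (LinearMap.IsIdempotentElem.isProj_range _
      (LinearMap.ext fun x => hS.apply_apply x))
  have hsum (T : E →L[𝕜] E) :
      re (LinearMap.trace 𝕜 E (T : E →ₗ[𝕜] E)) = ∑ i, re (inner 𝕜 (b i) (T (b i))) := by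
    rw [LinearMap.trace_eq_sum_inner _ b, map_sum]
    rfl
  have hnorm {S : E →L[𝕜] E} (hS : IsStarProjection S) (x : E) :
      re (inner 𝕜 x (S x)) = ‖S x‖ ^ 2 := by
    rw [← hS.apply_apply, ← hS.inner_apply_left, hS.apply_apply, inner_self_eq_norm_sq]
  have hRP : ∑ i, ‖R (b i)‖ ^ 2 = ∑ i, ‖P (b i)‖ ^ 2 := by
    simp_rw [← hnorm hR, ← hnorm hP, ← hsum, htr hR, htr hP, hrank]
  have hcross : ∑ i, re (inner 𝕜 (R (b i)) (P (b i))) = ∑ i, ‖R (P (b i))‖ ^ 2 := by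
    calc ∑ i, re (inner 𝕜 (R (b i)) (P (b i)))
        = re (LinearMap.trace 𝕜 E ((R : E →ₗ[𝕜] E) * (P : E →ₗ[𝕜] E))) := by
          rw [LinearMap.trace_eq_sum_inner _ b, map_sum]
          exact Finset.sum_congr rfl fun i _ => congrArg re (hR.inner_apply_left _ _)
      _ = re (LinearMap.trace 𝕜 E ((P : E →ₗ[𝕜] E) * ((R : E →ₗ[𝕜] E) * (P : E →ₗ[𝕜] E)))) := by
          rw [LinearMap.trace_mul_comm 𝕜 (P : E →ₗ[𝕜] E), mul_assoc]
          congr 3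
          exact LinearMap.ext fun x => (hP.apply_apply x).symm
      _ = ∑ i, ‖R (P (b i))‖ ^ 2 := by
          rw [LinearMap.trace_eq_sum_inner _ b, map_sum]
          refine Finset.sum_congr rfl fun i _ => ?_
          rw [← hnorm hR, hP.inner_apply_left]
          rfl
  have hsq : ∑ i, ‖(R - P) (b i)‖ ^ 2 = 2 * ∑ i, ‖P (b i) - R (P (b i))‖ ^ 2 := by
    have e1 (i : ι) : ‖P (b i) - R (P (b i))‖ ^ 2 = ‖P (b i)‖ ^ 2 - ‖R (P (b i))‖ ^ 2 := by
      rw [norm_sub_sq (𝕜 := 𝕜), hnorm hR]; ring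
    have e2 (i : ι) : ‖(R - P) (b i)‖ ^ 2 =
        ‖R (b i)‖ ^ 2 - 2 * re (inner 𝕜 (R (b i)) (P (b i))) + ‖P (b i)‖ ^ 2 := by
      rw [_root_.sub_apply, norm_sub_sq (𝕜 := 𝕜)]
    simp_rw [e1, e2, Finset.sum_add_distrib, Finset.sum_sub_distrib, ← Finset.mul_sum, hcross, hRP]
    ring
  set S := ∑ i, ‖P (b i) - R (P (b i))‖ with hS
  have hS0 : 0 ≤ S := Finset.sum_nonneg fun i _ => norm_nonneg _
  have hbi (i : ι) : ‖(R - P) (b i)‖ ≤ 2 * S := by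
    refine abs_le_of_sq_le_sq' ?_ (by positivity) |>.2
    calc ‖(R - P) (b i)‖ ^ 2 ≤ ∑ i, ‖(R - P) (b i)‖ ^ 2 :=
          Finset.single_le_sum (f := fun i => ‖(R - P) (b i)‖ ^ 2)
            (fun i _ => sq_nonneg _) (Finset.mem_univ i)
      _ ≤ 2 * S ^ 2 := by
          rw [hsq]
          gcongr
          exact Finset.sum_sq_le_sq_sum_of_nonneg fun i _ => norm_nonneg _
      _ ≤ (2 * S) ^ 2 := by nlinarith
  refine opNorm_le_bound _ (by positivity) fun x => ?_
  calc ‖(R - P) x‖ = ‖∑ i, inner 𝕜 (b i) x • (R - P) (b i)‖ := by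
        conv_lhs => rw [← b.sum_repr' x, map_sum]
        simp only [map_smul]
    _ ≤ ∑ i, ‖inner 𝕜 (b i) x • (R - P) (b i)‖ := norm_sum_le _ _
    _ ≤ ∑ _i : ι, ‖x‖ * (2 * S) := by
        refine Finset.sum_le_sum fun i _ => ?_
        rw [norm_smul]
        gcongr
        · simpa using norm_inner_le_norm (𝕜 := 𝕜) (b i) x
        · exact hbi i
    _ = Fintype.card ι * (2 * S) * ‖x‖ := by
        rw [Finset.sum_const, Finset.card_univ, nsmul_eq_mul]; ring

end Operators

section Decay

open Filter Topology RCLike ContinuousLinearMap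

lemma exists_forall_le_mul_pow {a : ℕ → ℝ} {C ρ : ℝ} (hρ : 0 < ρ)
    (h : ∀ᶠ k in atTop, a k ≤ C * ρ ^ k) : ∃ C' > 0, ∀ k, a k ≤ C' * ρ ^ k := by
  obtain ⟨D, hD⟩ := IsBoundedUnder.bddAbove_range (f := fun k => a k / ρ ^ k)
    ⟨C, eventually_map.2 (h.mono fun k hk => (div_le_iff₀ (pow_pos hρ k)).2 hk)⟩
  refine ⟨max D 1, by positivity, fun k => (div_le_iff₀ (pow_pos hρ k)).1 ?_⟩
  exact (hD ⟨k, rfl⟩).trans (le_max_left _ _)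

lemma exists_eventually_le_mul_pow_of_succ_le {e : ℕ → ℝ} {r : ℝ} (hr : 0 < r)
    (h : ∀ᶠ k in atTop, e (k + 1) ≤ r * e k) : ∃ C, ∀ᶠ k in atTop, e k ≤ C * r ^ k := by
  obtain ⟨K, hK⟩ := eventually_atTop.1 h
  refine ⟨e K / r ^ K, eventually_atTop.2 ⟨K, fun k hk => ?_⟩⟩
  induction k, hk using Nat.le_induction with
  | base => rw [div_mul_cancel₀ _ (pow_pos hr K).ne']
  | succ k hk ih =>
    calc e (k + 1) ≤ r * e k := hK k hk
      _ ≤ r * (e K / r ^ K * r ^ k) := by gcongr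
      _ = e K / r ^ K * r ^ (k + 1) := by ring

variable {𝕜 E : Type*} [RCLike 𝕜] [NormedAddCommGroup E] [InnerProductSpace 𝕜 E] [CompleteSpace E]

/-- A lower bound for the quadratic form of `H` on the complement of a projection persists, up to
`η`, along a sequence of projections converging to it. -/
lemma eventually_sub_mul_le_reApplyInnerSelf_compl {H P : E →L[𝕜] E} {Q : ℕ → E →L[𝕜] E} {l η : ℝ}
    (hQ : ∀ k, IsStarProjection (Q k)) (hP : IsStarProjection P) (hQP : Tendsto Q atTop (𝓝 P))
    (hl : ∀ x, l * ‖x - P x‖ ^ 2 ≤ H.reApplyInnerSelf (x - P x)) (hη : 0 < η) :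
    ∀ᶠ k in atTop, ∀ x, (l - η) * ‖x - Q k x‖ ^ 2 ≤ H.reApplyInnerSelf (x - Q k x) := by
  set M : (E →L[𝕜] E) → (E →L[𝕜] E) := fun S => (1 - S) * (H - (l : 𝕜) • 1) * (1 - S) with hM
  have hMc : Continuous M := by fun_prop
  have hform {S : E →L[𝕜] E} (hS : IsStarProjection S) (x : E) : (M S).reApplyInnerSelf x =
      H.reApplyInnerSelf (x - S x) - l * ‖x - S x‖ ^ 2 := by
    have h1 : (M S).reApplyInnerSelf x = (H - (l : 𝕜) • 1).reApplyInnerSelf (x - S x) := by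
      simp only [hM, reApplyInnerSelf_apply, mul_apply_eq_comp, _root_.sub_apply,
        one_apply_eq_self]
      rw [inner_sub_left, hS.inner_apply_left, ← inner_sub_right]
    rw [h1, reApplyInnerSelf_sub]
    simp only [reApplyInnerSelf_apply, _root_.smul_apply, one_apply_eq_self, inner_smul_left,
      conj_ofReal, re_ofReal_mul, inner_self_eq_norm_sq]
  have ht : ∀ᶠ k in atTop, ‖M (Q k) - M P‖ < η := by
    have := (hMc.tendsto P).comp hQP
    exact (tendsto_iff_norm_sub_tendsto_zero.1 this).eventually_lt_const hη
  filter_upwards [ht] with k hk x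
  have h1 := (abs_le.1 (abs_reApplyInnerSelf_le (M (Q k) - M P) (x - Q k x))).1
  have h2 : (x - Q k x) - Q k (x - Q k x) = x - Q k x := by simp [(hQ k).apply_apply]
  rw [reApplyInnerSelf_sub, hform (hQ k), hform hP, h2] at h1
  have h3 := hl (x - Q k x)
  have h4 := mul_le_mul_of_nonneg_right hk.le (sq_nonneg ‖x - Q k x‖)
  nlinarith

/-- Linear convergence of the iteration, tested on an eigenvector of `H` below the gap. -/
lemma exists_norm_compl_le_mul_pow {H P W₀ : E →L[𝕜] E} {W Q : ℕ → E →L[𝕜] E} {l μ β ρ : ℝ}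
    (hQ : ∀ k, IsStarProjection (Q k)) (hP : IsStarProjection P) (hQP : Tendsto Q atTop (𝓝 P))
    (hW : Tendsto W atTop (𝓝 W₀)) (hWQ : ∀ k, W k * Q k = 0)
    (hcomm : ∀ k, Commute (H + W k) (Q (k + 1)))
    (hl : ∀ x, l * ‖x - P x‖ ^ 2 ≤ H.reApplyInnerSelf (x - P x))
    (hsymm : (W₀ : E →ₗ[𝕜] E).IsSymmetric) (hnn : ∀ x, 0 ≤ W₀.reApplyInnerSelf x)
    (hβ : ∀ x, W₀.reApplyInnerSelf x ≤ β * ‖x‖ ^ 2) (hβ0 : 0 ≤ β) (hμ : μ < l)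
    (hρ : β / (β + (l - μ)) < ρ) (hρ1 : ρ < 1) {v : E} (hv : H v = (μ : 𝕜) • v) :
    ∃ C > 0, ∀ k, ‖v - Q k v‖ ≤ C * ρ ^ k := by
  have hpos : 0 < β + (l - μ) := by linarith
  have hρ0 : 0 < ρ := (div_nonneg hβ0 hpos.le).trans_lt hρ
  rw [div_lt_iff₀ hpos] at hρ
  obtain ⟨η, hη, hη1, hη2⟩ : ∃ η > 0, η ≤ (l - μ) / 3 ∧ η ≤ (ρ * (β + (l - μ)) - β) / 3 :=
    ⟨min ((l - μ) / 3) ((ρ * (β + (l - μ)) - β) / 3),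
      lt_min (by linarith) (by linarith), min_le_left _ _, min_le_right _ _⟩
  set e : ℕ → ℝ := fun k => W₀.reApplyInnerSelf (v - Q k v) + η * ‖v - Q k v‖ ^ 2 with he
  have hstep : ∀ᶠ k in atTop, e (k + 1) ≤ ρ ^ 2 * e k := by
    have h1 := (tendsto_add_atTop_nat 1).eventually
      (eventually_sub_mul_le_reApplyInnerSelf_compl hQ hP hQP hl hη)
    have h2 := (tendsto_iff_norm_sub_tendsto_zero.1 hW).eventually_lt_const hη
    filter_upwards [h1, h2] with k hk1 hk2
    have hy : W k v = W k (v - Q k v) := by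
      have : W k (Q k v) = 0 := DFunLike.congr_fun (hWQ k) v
      rw [map_sub, this, sub_zero]
    exact energy_compl_le (hQ (k + 1)) (hcomm k) hv hy (hk1 v) hk2.le hsymm hnn hβ hβ0 hη
      (by linarith) hρ0 (by nlinarith [mul_pos hη (sub_pos.2 hρ1)])
  obtain ⟨C, hC⟩ := exists_eventually_le_mul_pow_of_succ_le (pow_pos hρ0 2) hstep
  refine exists_forall_le_mul_pow (C := √(C / η)) hρ0 (hC.mono fun k hk => ?_)
  have h1 : η * ‖v - Q k v‖ ^ 2 ≤ C * (ρ ^ 2) ^ k := by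
    have := hnn (v - Q k v)
    simp only [he] at hk
    linarith
  rw [← Real.sqrt_sq (pow_pos hρ0 k).le, ← Real.sqrt_mul' _ (sq_nonneg _)]
  refine Real.le_sqrt_of_sq_le ?_
  rw [← pow_mul, mul_comm k 2, pow_mul, div_mul_eq_mul_div, le_div_iff₀ hη]
  linarith

end Decay

section Eigenprojection

open Filter Topology RCLike ContinuousLinearMap Module

variable {𝕜 E : Type*} [RCLike 𝕜] [NormedAddCommGroup E] [InnerProductSpace 𝕜 E]

lemma le_of_eigenvector_of_reApplyInnerSelf_le {H : E →L[𝕜] E} {v : E} {μ lm : ℝ} (hv0 : v ≠ 0)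
    (hv : H v = (μ : 𝕜) • v) (hle : H.reApplyInnerSelf v ≤ lm * ‖v‖ ^ 2) : μ ≤ lm := by
  rw [reApplyInnerSelf_apply, hv, inner_smul_left, conj_ofReal, re_ofReal_mul,
    inner_self_eq_norm_sq] at hle
  exact le_of_mul_le_mul_right hle (by positivity)

/-- Perturbation bound for spectral projections, in terms of the action of the perturbation `W` on
the unperturbed eigenspace. -/
lemma norm_sub_le_of_perturbation [FiniteDimensional 𝕜 E] [CompleteSpace E] {ι : Type*} [Fintype ι]
    (b : OrthonormalBasis ι 𝕜 E) {H W R P : E →L[𝕜] E} {μ : ι → ℝ} {lm c : ℝ}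
    (hb : ∀ i, H (b i) = (μ i : 𝕜) • b i)
    (hR : IsStarProjection R) (hP : IsStarProjection P)
    (hrank : finrank 𝕜 (R : E →ₗ[𝕜] E).range = finrank 𝕜 (P : E →ₗ[𝕜] E).range)
    (hHP : Commute H P) (hTR : Commute (H + W) R)
    (hle : ∀ x, H.reApplyInnerSelf (P x) ≤ lm * ‖P x‖ ^ 2) (hlm : lm < c)
    (hc : ∀ x, c * ‖x - R x‖ ^ 2 ≤ (H + W).reApplyInnerSelf (x - R x)) :
    ‖R - P‖ ≤ Fintype.card ι * (2 * ∑ i, ‖W (P (b i))‖ / (c - lm)) := by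
  refine (norm_sub_le_of_finrank_range_eq b hR hP hrank).trans ?_
  gcongr with i
  have hv : H (P (b i)) = (μ i : 𝕜) • P (b i) := by rw [hHP.clm_apply, hb, map_smul]
  rw [le_div_iff₀ (sub_pos.2 hlm)]
  by_cases h0 : P (b i) = 0
  · simp [h0]
  have hμ := le_of_eigenvector_of_reApplyInnerSelf_le h0 hv (hle _)
  have h1 := norm_compl_le_of_residual (w := W (P (b i))) hR hTR (by rw [_root_.add_apply, hv])
    (hc (P (b i)))
  have h2 := mul_le_mul_of_nonneg_right (sub_le_sub_left hμ c)
    (norm_nonneg (P (b i) - R (P (b i))))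
  linarith

end Eigenprojection

section CompressionAlgebra

variable {N : ℕ} {B Q : Matrix (Fin N) (Fin N) ℂ}

/-- The matrix inverted in the adaptive compression is nonsingular. -/
lemma isUnit_compression (hB : (-B).PosDef) (hQ : Q.IsHermitian) (hQQ : Q * Q = Q) :
    IsUnit (Q * B * Q + (1 - Q)) := by
  refine Matrix.mulVec_injective_iff_isUnit.1 ?_
  refine (injective_iff_map_eq_zero (Matrix.mulVecLin (Q * B * Q + (1 - Q)))).2 fun x hx => ?_
  have hx0 : (Q * B * Q + (1 - Q)) *ᵥ x = 0 := hx
  have h1 : (Q * B * Q) *ᵥ x = 0 := by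
    have : Q * (Q * B * Q + (1 - Q)) = Q * B * Q := by
      rw [mul_add, mul_sub, mul_one, hQQ, sub_self, add_zero, ← mul_assoc, ← mul_assoc, hQQ]
    rw [← this, ← mulVec_mulVec, hx0, mulVec_zero]
  have h2 : Q *ᵥ x = 0 := by
    by_contra h
    have h3 := hB.dotProduct_mulVec_pos h
    have h4 : star (Q *ᵥ x) ⬝ᵥ (-B) *ᵥ (Q *ᵥ x) = 0 := by
      rw [star_mulVec, hQ.eq, ← dotProduct_mulVec, neg_mulVec, mulVec_neg, mulVec_mulVec,
        mulVec_mulVec, h1, neg_zero, dotProduct_zero]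
    exact h3.ne' h4
  rw [add_mulVec, h1, zero_add, sub_mulVec, one_mulVec, h2, sub_zero] at hx0
  exact hx0

/-- The adaptive compression in terms of the pseudo-inverse of the compressed matrix. -/
lemma exists_acomp_eq (hB : (-B).PosDef) (hQ : Q.IsHermitian) (hQQ : Q * Q = Q) :
    ∃ G : Matrix (Fin N) (Fin N) ℂ, G.IsHermitian ∧ acomp B Q = B * G * B ∧ G * B * Q = Q ∧
      G * B * G = G := by
  obtain ⟨T, hT⟩ := isUnit_compression hB hQ hQQ
  have hTinv : (Q * B * Q + (1 - Q))⁻¹ = ↑T⁻¹ := by rw [← hT, Matrix.coe_units_inv]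
  set S : Matrix (Fin N) (Fin N) ℂ := ↑T⁻¹ with hS
  have hST : S * (Q * B * Q + (1 - Q)) = 1 := by rw [← hT]; exact T.inv_mul
  have hTS : (Q * B * Q + (1 - Q)) * S = 1 := by rw [← hT]; exact T.mul_inv
  have hBh : B.IsHermitian := by simpa using hB.isHermitian.neg
  have hcompl : (1 - Q) * Q = 0 := by rw [sub_mul, one_mul, hQQ, sub_self]
  have hcompl' : Q * (1 - Q) = 0 := by rw [mul_sub, mul_one, hQQ, sub_self]
  have hidem : (1 - Q) * (1 - Q) = 1 - Q := by rw [sub_mul, one_mul, hcompl', sub_zero]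
  have hS1 : S * (1 - Q) = 1 - Q := by
    calc S * (1 - Q) = S * ((Q * B * Q + (1 - Q)) * (1 - Q)) := by
          rw [add_mul, mul_assoc (Q * B), hcompl', mul_zero, zero_add, hidem]
      _ = 1 - Q := by rw [← mul_assoc, hST, one_mul]
  have hS2 : (1 - Q) * S = 1 - Q := by
    calc (1 - Q) * S = ((1 - Q) * (Q * B * Q + (1 - Q))) * S := by
          rw [mul_add, ← mul_assoc, ← mul_assoc, hcompl, zero_mul, zero_mul, zero_add, hidem]
      _ = 1 - Q := by rw [mul_assoc, hTS, mul_one]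
  have hSh : S.IsHermitian := by
    rw [← hTinv]
    refine Matrix.IsHermitian.inv (Matrix.IsHermitian.add ?_ (Matrix.isHermitian_one.sub hQ))
    simpa [hQ.eq] using Matrix.isHermitian_mul_mul_conjTranspose Q hBh
  have hGQ : (S - (1 - Q)) * Q = S - (1 - Q) := by
    rw [sub_mul, hcompl, sub_zero, eq_sub_iff_add_eq]
    nth_rewrite 1 [← hS1]
    rw [← mul_add, add_sub_cancel, mul_one]
  have hQG : Q * (S - (1 - Q)) = S - (1 - Q) := by
    rw [mul_sub, hcompl', sub_zero, eq_sub_iff_add_eq]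
    nth_rewrite 1 [← hS2]
    rw [← add_mul, add_sub_cancel, one_mul]
  have hGBQ : (S - (1 - Q)) * B * Q = Q := by
    calc (S - (1 - Q)) * B * Q = (S - (1 - Q)) * (Q * B * Q) := by
          nth_rewrite 1 [← hGQ]
          simp only [mul_assoc]
      _ = S * (Q * B * Q) := by
          rw [sub_mul, ← mul_assoc (1 - Q), ← mul_assoc (1 - Q), hcompl, zero_mul, zero_mul,
            sub_zero]
      _ = S * (Q * B * Q + (1 - Q)) - S * (1 - Q) := by rw [mul_add, add_sub_cancel_right]
      _ = Q := by rw [hST, hS1, sub_sub_cancel]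
  refine ⟨S - (1 - Q), hSh.sub (Matrix.isHermitian_one.sub hQ), ?_, hGBQ, ?_⟩
  · rw [acomp, hTinv, ← sub_mul, ← mul_sub]
  · nth_rewrite 2 [← hQG]
    rw [← mul_assoc, hGBQ, hQG]

lemma acomp_sub_self_mul (hB : (-B).PosDef) (hQ : Q.IsHermitian) (hQQ : Q * Q = Q) :
    (acomp B Q - B) * Q = 0 := by
  obtain ⟨G, -, hG, hGQ, -⟩ := exists_acomp_eq hB hQ hQQ
  rw [sub_mul, hG, mul_assoc B, mul_assoc, hGQ, sub_self]

lemma acomp_sub_self_posSemidef (hB : (-B).PosDef) (hQ : Q.IsHermitian) (hQQ : Q * Q = Q) :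
    (acomp B Q - B).PosSemidef := by
  obtain ⟨G, hGh, hG, -, hGG⟩ := exists_acomp_eq hB hQ hQQ
  have hBh : B.IsHermitian := by simpa using hB.isHermitian.neg
  have h := hB.posSemidef.conjTranspose_mul_mul_same (1 - G * B)
  rw [conjTranspose_sub, conjTranspose_mul, hBh.eq, hGh.eq, conjTranspose_one] at h
  have hBGB : B * G * (B * (G * B)) = B * (G * B) := by
    calc B * G * (B * (G * B)) = B * (G * B * G) * B := by simp only [mul_assoc]
      _ = B * (G * B) := by rw [hGG, mul_assoc]
  convert h using 1
  rw [hG]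
  simp only [sub_mul, mul_sub, one_mul, mul_one, mul_neg, neg_mul, mul_assoc] at hBGB ⊢
  rw [hBGB]
  abel

lemma neg_acomp_posSemidef (hB : (-B).PosDef) (hQ : Q.IsHermitian) (hQQ : Q * Q = Q) :
    (-acomp B Q).PosSemidef := by
  obtain ⟨G, hGh, hG, -, hGG⟩ := exists_acomp_eq hB hQ hQQ
  have hBh : B.IsHermitian := by simpa using hB.isHermitian.neg
  have h := hB.posSemidef.conjTranspose_mul_mul_same (G * B)
  rw [conjTranspose_mul, hBh.eq, hGh.eq] at h
  convert h using 1
  rw [hG, mul_neg, neg_mul, neg_inj]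
  calc B * G * B = B * (G * B * G) * B := by rw [hGG]
    _ = B * G * B * (G * B) := by simp only [mul_assoc]

open scoped Matrix.Norms.L2Operator in
/-- The adaptive compression is continuous at every orthogonal projector. -/
lemma continuousAt_acomp (hB : (-B).PosDef) (hQ : Q.IsHermitian) (hQQ : Q * Q = Q) :
    ContinuousAt (acomp B) Q := by
  have hinv : ContinuousAt (fun X : Matrix (Fin N) (Fin N) ℂ => (X * B * X + (1 - X))⁻¹) Q := by
    simp_rw [Matrix.nonsing_inv_eq_ringInverse]
    obtain ⟨T, hT⟩ := isUnit_compression hB hQ hQQ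
    have h := NormedRing.inverse_continuousAt T
    rw [hT] at h
    exact ContinuousAt.comp (f := fun X : Matrix (Fin N) (Fin N) ℂ => X * B * X + (1 - X)) h
      (by fun_prop)
  have h2 : ContinuousAt (fun X : Matrix (Fin N) (Fin N) ℂ => B * (1 - X) * B) Q := by fun_prop
  exact (((continuousAt_const (y := B)).mul hinv).mul continuousAt_const).sub h2

end CompressionAlgebra

section Bridge

open Module ContinuousLinearMap

variable {N : ℕ}

local notation "op" => (toEuclideanCLM (n := Fin N) (𝕜 := ℂ))

lemma reApplyInnerSelf_toEuclideanCLM (M : Matrix (Fin N) (Fin N) ℂ)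
    (x : EuclideanSpace ℂ (Fin N)) :
    (op M).reApplyInnerSelf x = (star (M *ᵥ x.ofLp) ⬝ᵥ x.ofLp).re := by
  rw [reApplyInnerSelf_apply, EuclideanSpace.inner_eq_star_dotProduct, ofLp_toEuclideanCLM,
    dotProduct_comm]
  rfl

lemma isSymmetric_toEuclideanCLM {M : Matrix (Fin N) (Fin N) ℂ} (hM : M.IsHermitian) :
    (op M : EuclideanSpace ℂ (Fin N) →ₗ[ℂ] _).IsSymmetric := by
  have : IsSelfAdjoint (op M) := IsSelfAdjoint.map (f := op) hM
  exact this.isSymmetric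

lemma reApplyInnerSelf_toEuclideanCLM' {M : Matrix (Fin N) (Fin N) ℂ} (hM : M.IsHermitian)
    (x : EuclideanSpace ℂ (Fin N)) :
    (op M).reApplyInnerSelf x = (star x.ofLp ⬝ᵥ M *ᵥ x.ofLp).re := by
  rw [reApplyInnerSelf_toEuclideanCLM, star_mulVec, hM.eq, dotProduct_mulVec]

lemma reApplyInnerSelf_nonneg_of_posSemidef {M : Matrix (Fin N) (Fin N) ℂ} (hM : M.PosSemidef)
    (x : EuclideanSpace ℂ (Fin N)) : 0 ≤ (op M).reApplyInnerSelf x := by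
  rw [reApplyInnerSelf_toEuclideanCLM' hM.isHermitian]
  exact (Complex.le_def.1 (hM.dotProduct_mulVec_nonneg x.ofLp)).1

lemma specNorm_eq_norm (M : Matrix (Fin N) (Fin N) ℂ) : specNorm M = ‖op M‖ := rfl

lemma IsProjOfRank.isStarProjection {r : ℕ} {Q : Matrix (Fin N) (Fin N) ℂ}
    (h : IsProjOfRank r Q) : IsStarProjection (op Q) where
  isIdempotentElem := by
    rw [IsIdempotentElem, ← map_mul, h.2.1]
  isSelfAdjoint := IsSelfAdjoint.map (f := op) h.1

lemma IsProjOfRank.finrank_range {r : ℕ} {Q : Matrix (Fin N) (Fin N) ℂ}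
    (h : IsProjOfRank r Q) :
    finrank ℂ (op Q : EuclideanSpace ℂ (Fin N) →ₗ[ℂ] EuclideanSpace ℂ (Fin N)).range = r := by
  rw [← h.2.2, Matrix.rank_eq_finrank_range_toLin Q (EuclideanSpace.basisFun (Fin N) ℂ).toBasis
    (EuclideanSpace.basisFun (Fin N) ℂ).toBasis]
  congr 2

lemma IsBottomEigenproj.commute {r : ℕ} {H R : Matrix (Fin N) (Fin N) ℂ}
    (h : IsBottomEigenproj r H R) : Commute (op H) (op R) :=
  (show Commute H R from h.2.1).map op

lemma IsBottomEigenproj.reApplyInnerSelf_le {r : ℕ} {H R : Matrix (Fin N) (Fin N) ℂ}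
    (hH : H.IsHermitian) (h : IsBottomEigenproj r H R) (x : EuclideanSpace ℂ (Fin N)) :
    (op H).reApplyInnerSelf (op R x) ≤ eig H r * ‖op R x‖ ^ 2 := by
  have h1 := h.2.2 (op R x).ofLp ⟨x.ofLp, rfl⟩
  rw [reApplyInnerSelf_toEuclideanCLM' hH, ← inner_self_eq_norm_sq (𝕜 := ℂ),
    EuclideanSpace.inner_eq_star_dotProduct, dotProduct_comm (op R x).ofLp (star _)]
  exact h1

lemma eigenvectorBasis_toEuclideanCLM {H : Matrix (Fin N) (Fin N) ℂ} (hH : H.IsHermitian)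
    (i : Fin N) : op H (hH.eigenvectorBasis i) =
      ((hH.eigenvalues i : ℝ) : ℂ) • hH.eigenvectorBasis i := by
  apply (WithLp.ofLp_injective 2)
  rw [ofLp_toEuclideanCLM, hH.mulVec_eigenvectorBasis]
  rfl

/-- Courant–Fischer: a subspace of dimension at least `i` contains a nonzero vector whose Rayleigh
quotient is at least the `i`-th smallest eigenvalue. -/
lemma exists_eig_mul_le_reApplyInnerSelf {H : Matrix (Fin N) (Fin N) ℂ} (hH : H.IsHermitian) {i : ℕ}
    (hi1 : 1 ≤ i) (hiN : i ≤ N) (U : Submodule ℂ (EuclideanSpace ℂ (Fin N)))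
    (hU : i ≤ finrank ℂ U) :
    ∃ z ∈ U, z ≠ 0 ∧ eig H i * ‖z‖ ^ 2 ≤ (op H).reApplyInnerSelf z := by
  set b := hH.eigenvectorBasis
  set σ := Tuple.sort hH.eigenvalues with hσ
  have hi : i - 1 < N := by omega
  have heig : eig H i = hH.eigenvalues (σ ⟨i - 1, hi⟩) := by
    simp only [eig, hH, hi, dite_true, hσ]
  let f : U →ₗ[ℂ] (Fin (i - 1) → ℂ) :=
    (LinearMap.pi fun j : Fin (i - 1) =>
      (innerₛₗ ℂ (b (σ ⟨j, j.2.trans hi⟩)))) ∘ₗ U.subtype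
  have hker : f.ker ≠ ⊥ := LinearMap.ker_ne_bot_of_finrank_lt (by
    rw [finrank_fin_fun]; omega)
  obtain ⟨z, hz, hz0⟩ := Submodule.exists_mem_ne_zero_of_ne_bot hker
  refine ⟨z, z.2, fun h => hz0 (Subtype.ext h), ?_⟩
  have hort (j : Fin N) (hj : (j : ℕ) < i - 1) : inner ℂ (b (σ j)) (z : EuclideanSpace ℂ _) = 0 :=
    congrFun hz ⟨j, hj⟩
  have hquad : (op H).reApplyInnerSelf z =
      ∑ j, hH.eigenvalues (σ j) * ‖inner ℂ (b (σ j)) (z : EuclideanSpace ℂ _)‖ ^ 2 := by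
    rw [Equiv.sum_comp σ fun j => hH.eigenvalues j * ‖inner ℂ (b j) (z : EuclideanSpace ℂ _)‖ ^ 2,
      reApplyInnerSelf_apply, ← b.sum_inner_mul_inner, map_sum]
    refine Finset.sum_congr rfl fun j _ => ?_
    have h1 : inner ℂ (op H z) (b j) =
        (hH.eigenvalues j : ℂ) * inner ℂ (z : EuclideanSpace ℂ _) (b j) := by
      rw [← inner_smul_right, ← eigenvectorBasis_toEuclideanCLM hH]
      exact isSymmetric_toEuclideanCLM hH _ _
    rw [h1, mul_assoc, RCLike.re_eq_complex_re, Complex.re_ofReal_mul, ← inner_conj_symm,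
      Complex.conj_mul', ← Complex.ofReal_pow, Complex.ofReal_re]
  rw [heig, hquad, ← b.sum_sq_norm_inner_right, Finset.mul_sum,
    ← Equiv.sum_comp σ]
  refine Finset.sum_le_sum fun j _ => ?_
  rcases lt_or_ge (j : ℕ) (i - 1) with hj | hj
  · simp [hort j hj]
  · gcongr
    exact Tuple.monotone_sort hH.eigenvalues (show (⟨i - 1, hi⟩ : Fin N) ≤ j from hj)

lemma eig_mono {H : Matrix (Fin N) (Fin N) ℂ} (hH : H.IsHermitian) {i j : ℕ} (hij : i ≤ j)
    (hj1 : 1 ≤ j) (hjN : j ≤ N) : eig H i ≤ eig H j := by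
  have hi : i - 1 < N := by omega
  have hj : j - 1 < N := by omega
  simp only [eig, hH, hi, hj, dite_true]
  exact Tuple.monotone_sort hH.eigenvalues
    (show (⟨i - 1, hi⟩ : Fin N) ≤ ⟨j - 1, hj⟩ from Nat.sub_le_sub_right hij 1)

lemma IsProjOfRank.eig_le {r : ℕ} {H P : Matrix (Fin N) (Fin N) ℂ} (hH : H.IsHermitian)
    (hr1 : 1 ≤ r) (hrN : r ≤ N) (hP : IsProjOfRank r P) {c : ℝ}
    (hc : ∀ x, (op H).reApplyInnerSelf (op P x) ≤ c * ‖op P x‖ ^ 2) : eig H r ≤ c := by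
  obtain ⟨z, ⟨x, rfl⟩, hz0, hz⟩ :=
    exists_eig_mul_le_reApplyInnerSelf hH hr1 hrN _ hP.finrank_range.ge
  exact le_of_mul_le_mul_right (hz.trans (hc x)) (pow_pos (norm_pos_iff.2 hz0) 2)

lemma IsBottomEigenproj.le_reApplyInnerSelf_compl {r : ℕ} {H W R : Matrix (Fin N) (Fin N) ℂ}
    (hH : H.IsHermitian) (hW : W.PosSemidef) (hrN : r < N) (hR : IsBottomEigenproj r (H + W) R)
    (hgap : eig (H + W) r < eig H (r + 1)) (x : EuclideanSpace ℂ (Fin N)) :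
    eig H (r + 1) * ‖x - op R x‖ ^ 2 ≤ (op H + op W).reApplyInnerSelf (x - op R x) := by
  rw [← map_add]
  refine _root_.le_reApplyInnerSelf_compl (H := op H) hR.1.isStarProjection hR.commute (fun z => ?_)
    (hR.reApplyInnerSelf_le (hH.add hW.isHermitian)) hgap (fun U hU => ?_) x
  · rw [map_add, reApplyInnerSelf_add]
    exact le_add_of_nonneg_right (reApplyInnerSelf_nonneg_of_posSemidef hW z)
  · rw [hR.1.finrank_range] at hU
    exact exists_eig_mul_le_reApplyInnerSelf hH (by omega) (by omega) U hU

lemma IsBottomEigenproj.specNorm_sub_le {r : ℕ} {H W R P : Matrix (Fin N) (Fin N) ℂ}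
    (hH : H.IsHermitian) (hW : W.PosSemidef) (hrN : r < N) (hP : IsBottomEigenproj r H P)
    (hR : IsBottomEigenproj r (H + W) R) (hgap : eig (H + W) r < eig H (r + 1))
    (hgapH : eig H r < eig H (r + 1)) :
    specNorm (R - P) ≤ N * (2 * ∑ i, ‖op W (op P (hH.eigenvectorBasis i))‖ /
      (eig H (r + 1) - eig H r)) := by
  have h := norm_sub_le_of_perturbation hH.eigenvectorBasis (H := op H) (W := op W)
    (eigenvectorBasis_toEuclideanCLM hH) hR.1.isStarProjection hP.1.isStarProjection
    (hR.1.finrank_range.trans hP.1.finrank_range.symm) hP.commute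
    (by rw [← map_add]; exact hR.commute) (hP.reApplyInnerSelf_le hH) hgapH
    (hR.le_reApplyInnerSelf_compl hH hW hrN hgap)
  rwa [Fintype.card_fin, ← map_sub] at h

lemma IsBottomEigenproj.le_reApplyInnerSelf_compl_self {r : ℕ} {H P : Matrix (Fin N) (Fin N) ℂ}
    (hH : H.IsHermitian) (hrN : r < N) (hP : IsBottomEigenproj r H P)
    (hgap : eig H r < eig H (r + 1)) (x : EuclideanSpace ℂ (Fin N)) :
    eig H (r + 1) * ‖x - op P x‖ ^ 2 ≤ (op H).reApplyInnerSelf (x - op P x) := by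
  have hP0 : IsBottomEigenproj r (H + 0) P := by rwa [add_zero]
  have h := hP0.le_reApplyInnerSelf_compl hH PosSemidef.zero hrN (by rwa [add_zero]) x
  rwa [map_zero, add_zero] at h

/-- A positive semidefinite perturbation vanishing on the bottom eigenspace does not change it. -/
lemma IsBottomEigenproj.eq_of_mul_eq_zero {r : ℕ} {H W R P : Matrix (Fin N) (Fin N) ℂ}
    (hH : H.IsHermitian) (hW : W.PosSemidef) (hr1 : 1 ≤ r) (hrN : r < N)
    (hP : IsBottomEigenproj r H P) (hR : IsBottomEigenproj r (H + W) R)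
    (hgapH : eig H r < eig H (r + 1)) (hWP : W * P = 0) : R = P := by
  have hWP' (x : EuclideanSpace ℂ (Fin N)) : op W (op P x) = 0 := by
    have h := map_mul op W P
    rw [hWP, map_zero] at h
    exact (DFunLike.congr_fun h x).symm
  have hle : eig (H + W) r ≤ eig H r := by
    refine hP.1.eig_le (hH.add hW.isHermitian) hr1 hrN.le fun x => ?_
    have h : (op W).reApplyInnerSelf (op P x) = 0 := by simp [reApplyInnerSelf_apply, hWP']
    rw [map_add, reApplyInnerSelf_add, h, add_zero]
    exact hP.reApplyInnerSelf_le hH x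
  have h := hP.specNorm_sub_le hH hW hrN hR (hle.trans_lt hgapH) hgapH
  simp only [hWP', norm_zero, zero_div, Finset.sum_const_zero, mul_zero] at h
  rw [specNorm_eq_norm] at h
  have h0 : op (R - P) = 0 := norm_le_zero_iff.1 h
  exact sub_eq_zero.1 ((map_eq_zero_iff op (op).injective).1 h0)

lemma IsBottomEigenproj.mul_eq_of_le {m n : ℕ} {H P Pm : Matrix (Fin N) (Fin N) ℂ}
    (hH : H.IsHermitian) (hmn : m ≤ n) (hn1 : 1 ≤ n) (hnN : n < N)
    (hP : IsBottomEigenproj n H P) (hPm : IsBottomEigenproj m H Pm)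
    (hgap : eig H n < eig H (n + 1)) : P * Pm = Pm := by
  refine (op).injective (ContinuousLinearMap.coe_injective
    (hH.eigenvectorBasis.toBasis.ext fun i => ?_))
  set v := op Pm (hH.eigenvectorBasis i) with hv
  suffices h : op P v = v by
    rw [OrthonormalBasis.coe_toBasis, map_mul]
    exact h
  have hHv : op H v = ((hH.eigenvalues i : ℝ) : ℂ) • v := by
    rw [hv, hPm.commute.clm_apply, eigenvectorBasis_toEuclideanCLM, map_smul]
  by_cases h0 : v = 0
  · rw [h0, map_zero]
  have hμ : hH.eigenvalues i ≤ eig H m :=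
    le_of_eigenvector_of_reApplyInnerSelf_le h0 hHv (hPm.reApplyInnerSelf_le hH _)
  have hmono := eig_mono hH hmn hn1 hnN.le
  have h := norm_compl_le_of_residual (w := 0) (μ := hH.eigenvalues i) hP.1.isStarProjection
    hP.commute (by rw [add_zero]; exact hHv) (hP.le_reApplyInnerSelf_compl_self hH hnN hgap v)
  rw [norm_zero] at h
  have h2 : ‖v - op P v‖ ≤ 0 := nonpos_of_mul_nonpos_right h (by linarith)
  exact (sub_eq_zero.1 (norm_le_zero_iff.1 h2)).symm

end Bridge

section Convergence

open Filter Topology ContinuousLinearMap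

variable {N : ℕ}

local notation "op" => (toEuclideanCLM (n := Fin N) (𝕜 := ℂ))

open scoped Matrix.Norms.L2Operator in
lemma tendsto_specNorm_sub_iff {M : Matrix (Fin N) (Fin N) ℂ}
    {Ms : ℕ → Matrix (Fin N) (Fin N) ℂ} :
    Tendsto (fun k => specNorm (Ms k - M)) atTop (𝓝 0) ↔ Tendsto Ms atTop (𝓝 M) := by
  have h (X : Matrix (Fin N) (Fin N) ℂ) : specNorm X = ‖X‖ := rfl
  simp_rw [h]
  exact tendsto_iff_norm_sub_tendsto_zero.symm

lemma tendsto_toEuclideanCLM {M : Matrix (Fin N) (Fin N) ℂ} {Ms : ℕ → Matrix (Fin N) (Fin N) ℂ}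
    (h : Tendsto (fun k => specNorm (Ms k - M)) atTop (𝓝 0)) :
    Tendsto (fun k => op (Ms k)) atTop (𝓝 (op M)) := by
  simp_rw [specNorm_eq_norm, map_sub] at h
  exact tendsto_iff_norm_sub_tendsto_zero.2 h

/-- Linear convergence of the bottom eigenprojectors of the compressed matrices, with a constant
that is not normalised by the initial error. -/
lemma exists_specNorm_sub_le_mul_pow {n m : ℕ} (hm1 : 1 ≤ m) (hmn : m ≤ n) (hnN : n < N)
    {A B : Matrix (Fin N) (Fin N) ℂ} (hA : A.IsHermitian) (hB : (-B).PosDef)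
    (hgapn : eig (A + B) n < eig (A + B) (n + 1)) (hgapm : eig (A + B) m < eig (A + B) (m + 1))
    {P Pm : Matrix (Fin N) (Fin N) ℂ} (hP : IsBottomEigenproj n (A + B) P)
    (hPm : IsBottomEigenproj m (A + B) Pm) {Ps Pms : ℕ → Matrix (Fin N) (Fin N) ℂ}
    (hPs : ∀ k, IsProjOfRank n (Ps k))
    (hPsIter : ∀ k, IsBottomEigenproj n (A + acomp B (Ps k)) (Ps (k + 1)))
    (hconv : Tendsto (fun k => specNorm (Ps k - P)) atTop (𝓝 0))
    (hPms : ∀ k, IsBottomEigenproj m (A + acomp B (Ps k)) (Pms k)) {ρ : ℝ}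
    (hρ : specNorm B / (specNorm B + (eig (A + B) (n + 1) - eig (A + B) m)) < ρ) (hρ1 : ρ < 1) :
    ∃ C > 0, ∀ k, specNorm (Pms k - Pm) ≤ C * ρ ^ k := by
  have hBh : B.IsHermitian := by simpa using hB.isHermitian.neg
  have hadd (Q : Matrix (Fin N) (Fin N) ℂ) : A + B + (acomp B Q - B) = A + acomp B Q := by abel
  simp_rw [← hadd] at hPsIter hPms
  have hpsd {r : ℕ} {Q : Matrix (Fin N) (Fin N) ℂ} (hQ : IsProjOfRank r Q) :=
    acomp_sub_self_posSemidef hB hQ.1 hQ.2.1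
  have hmono := eig_mono (hA.add hBh) hmn (hm1.trans hmn) hnN.le
  have hβ0 : 0 ≤ specNorm B := norm_nonneg _
  have hρ0 : 0 < ρ := (div_nonneg hβ0 (by linarith)).trans_lt hρ
  have hWlim :
      Tendsto (fun k => specNorm ((acomp B (Ps k) - B) - (acomp B P - B))) atTop (𝓝 0) := by
    simp_rw [sub_sub_sub_cancel_right]
    exact tendsto_specNorm_sub_iff.2 ((continuousAt_acomp hB hP.1.1 hP.1.2.1).tendsto.comp
      (tendsto_specNorm_sub_iff.1 hconv))
  have hPPm := hP.mul_eq_of_le (hA.add hBh) hmn (hm1.trans hmn) hnN hPm hgapn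
  have hWPm : (acomp B P - B) * Pm = 0 := by
    rw [← hPPm, ← mul_assoc, acomp_sub_self_mul hB hP.1.1 hP.1.2.1, zero_mul]
  have hβ (x : EuclideanSpace ℂ (Fin N)) :
      (op (acomp B P - B)).reApplyInnerSelf x ≤ specNorm B * ‖x‖ ^ 2 := by
    have h1 := reApplyInnerSelf_nonneg_of_posSemidef (neg_acomp_posSemidef hB hP.1.1 hP.1.2.1) x
    have h2 := (abs_le.1 (abs_reApplyInnerSelf_le (op B) x)).1
    rw [← zero_sub, map_sub, reApplyInnerSelf_sub, map_zero] at h1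
    rw [map_sub, reApplyInnerSelf_sub, specNorm_eq_norm]
    have h3 : (0 : EuclideanSpace ℂ (Fin N) →L[ℂ] _).reApplyInnerSelf x = 0 := by
      simp [reApplyInnerSelf_apply]
    linarith
  generalize hH : A + B = H at *
  have hHh : H.IsHermitian := hH ▸ hA.add hBh
  set b := hHh.eigenvectorBasis
  have hdecay (i : Fin N) : ∃ C > 0, ∀ k,
      ‖op Pm (b i) - op (Ps k) (op Pm (b i))‖ ≤ C * ρ ^ k := by
    by_cases h0 : op Pm (b i) = 0
    · exact ⟨1, one_pos, fun k => by rw [h0, map_zero, sub_zero, norm_zero]; positivity⟩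
    have hv : op H (op Pm (b i)) = ((hHh.eigenvalues i : ℝ) : ℂ) • op Pm (b i) := by
      rw [hPm.commute.clm_apply, eigenvectorBasis_toEuclideanCLM, map_smul]
    have hμ : hHh.eigenvalues i ≤ eig H m :=
      le_of_eigenvector_of_reApplyInnerSelf_le h0 hv (hPm.reApplyInnerSelf_le hHh _)
    refine exists_norm_compl_le_mul_pow (H := op H) (P := op P) (W₀ := op (acomp B P - B))
      (W := fun k => op (acomp B (Ps k) - B)) (Q := fun k => op (Ps k)) (l := eig H (n + 1))
      (μ := hHh.eigenvalues i) (fun k => (hPs k).isStarProjection) hP.1.isStarProjection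
      (tendsto_toEuclideanCLM hconv)
      (tendsto_toEuclideanCLM hWlim) (fun k => ?_) (fun k => ?_)
      (hP.le_reApplyInnerSelf_compl_self hHh hnN hgapn)
      (isSymmetric_toEuclideanCLM (hpsd hP.1).isHermitian)
      (reApplyInnerSelf_nonneg_of_posSemidef (hpsd hP.1)) hβ hβ0
      ((hμ.trans hmono).trans_lt hgapn) (lt_of_le_of_lt ?_ hρ) hρ1 hv
    · rw [← map_mul, acomp_sub_self_mul hB (hPs k).1 (hPs k).2.1, map_zero]
    · rw [← map_add]
      exact (hPsIter k).commute
    · have hpos : 0 < specNorm B + (eig H (n + 1) - eig H m) := by linarith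
      gcongr
  choose C hC0 hC using hdecay
  have hWb : ∀ᶠ k in atTop, ‖op (acomp B (Ps k) - B)‖ < ‖op (acomp B P - B)‖ + 1 :=
    (tendsto_toEuclideanCLM hWlim).norm.eventually_lt_const (lt_add_one _)
  have hδ := hWlim.eventually_lt_const (sub_pos.2 hgapm)
  refine exists_forall_le_mul_pow (C := N * (2 * ∑ i, (‖op (acomp B P - B)‖ + 1) * C i /
    (eig H (m + 1) - eig H m))) hρ0 ?_
  filter_upwards [hWb, hδ] with k hk1 hk2
  have hlt : eig (H + (acomp B (Ps k) - B)) m < eig H (m + 1) := by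
    refine lt_of_le_of_lt (hPm.1.eig_le (c := eig H m +
      specNorm ((acomp B (Ps k) - B) - (acomp B P - B))) (hHh.add (hpsd (hPs k)).isHermitian) hm1
      (hmn.trans hnN.le) fun x => ?_) (lt_sub_iff_add_lt'.1 hk2)
    have h1 := hPm.reApplyInnerSelf_le hHh x
    have h2 := (abs_le.1 (abs_reApplyInnerSelf_le
      (op ((acomp B (Ps k) - B) - (acomp B P - B))) (op Pm x))).2
    have h3 : op (acomp B P - B) (op Pm x) = 0 := by
      have h := map_mul op (acomp B P - B) Pm
      rw [hWPm, map_zero] at h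
      exact (DFunLike.congr_fun h x).symm
    have h4 : (op (acomp B P - B)).reApplyInnerSelf (op Pm x) = 0 := by
      simp only [reApplyInnerSelf_apply, h3, inner_zero_left, map_zero]
    rw [map_sub, reApplyInnerSelf_sub, h4, sub_zero, ← map_sub, ← specNorm_eq_norm] at h2
    rw [map_add, reApplyInnerSelf_add, add_mul]
    exact add_le_add h1 h2
  refine (hPm.specNorm_sub_le hHh (hpsd (hPs k)) (by omega) (hPms k) hlt hgapm).trans ?_
  rw [mul_assoc, mul_assoc, Finset.sum_mul]
  gcongr with i
  rw [div_mul_eq_mul_div]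
  have hpos := sub_pos.2 hgapm
  gcongr
  have hy : op (acomp B (Ps k) - B) (op Pm (b i)) =
      op (acomp B (Ps k) - B) (op Pm (b i) - op (Ps k) (op Pm (b i))) := by
    have h := map_mul op (acomp B (Ps k) - B) (Ps k)
    rw [acomp_sub_self_mul hB (hPs k).1 (hPs k).2.1, map_zero] at h
    have h' := DFunLike.congr_fun h (op Pm (b i))
    rw [map_sub _ (op Pm (b i))]
    exact (sub_eq_self.2 h'.symm).symm
  rw [hy, mul_assoc]
  exact (le_opNorm _ _).trans (mul_le_mul hk1.le (hC i k) (norm_nonneg _) (by positivity))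

end Convergence

/-- **Convergence of sub-projectors (Theorem `sub-projector`).** Let `P`, `P_m` be the
bottom-`n` and bottom-`m` eigenprojectors of `A+B` (`m ≤ n < N`, both gaps positive),
and `Δ_m = λ_{n+1}{A+B} − λ_m{A+B}`. Suppose `(P^(k))` is an adaptive compression
iteration sequence with `P^(k) → P`, and for `k ≥ 1` let `P_m^(k)` be a bottom-`m`
eigenprojector of `A + B̃[P^(k−1)]`. Then `P_m^(k) → P_m`, and for every rate
`ρ ∈ (‖B‖₂/(‖B‖₂+Δ_m), 1)` there is `C > 0` with
`‖P_m^(k) − P_m‖₂ ≤ C ρ^k ‖P^(0) − P‖₂` for all `k ≥ 1`. -/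
theorem acomp_subprojector_convergence {N n m : ℕ} (hm1 : 1 ≤ m) (hmn : m ≤ n)
    (hnN : n < N)
    (A B : Matrix (Fin N) (Fin N) ℂ) (hA : A.IsHermitian) (hB : (-B).PosDef)
    (hgapn : eig (A + B) n < eig (A + B) (n + 1))
    (hgapm : eig (A + B) m < eig (A + B) (m + 1))
    (P : Matrix (Fin N) (Fin N) ℂ) (hP : IsBottomEigenproj n (A + B) P)
    (Pm : Matrix (Fin N) (Fin N) ℂ) (hPm : IsBottomEigenproj m (A + B) Pm)
    (Ps : ℕ → Matrix (Fin N) (Fin N) ℂ)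
    (hPs : ∀ k : ℕ, IsProjOfRank n (Ps k))
    (hPsIter : ∀ k : ℕ, IsBottomEigenproj n (A + acomp B (Ps k)) (Ps (k + 1)))
    (hconv : Filter.Tendsto (fun k => specNorm (Ps k - P)) Filter.atTop (nhds 0))
    (Pms : ℕ → Matrix (Fin N) (Fin N) ℂ)
    (hPms : ∀ k : ℕ, 1 ≤ k → IsBottomEigenproj m (A + acomp B (Ps (k - 1))) (Pms k)) :
    Filter.Tendsto (fun k => specNorm (Pms k - Pm)) Filter.atTop (nhds 0) ∧
    ∀ ρ : ℝ,
      specNorm B / (specNorm B + (eig (A + B) (n + 1) - eig (A + B) m)) < ρ → ρ < 1 →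
      ∃ C : ℝ, 0 < C ∧ ∀ k : ℕ, 1 ≤ k →
        specNorm (Pms k - Pm) ≤ C * ρ ^ k * specNorm (Ps 0 - P) := by
  have hBh : B.IsHermitian := by simpa using hB.isHermitian.neg
  have hPms' (k : ℕ) : IsBottomEigenproj m (A + acomp B (Ps k)) (Pms (k + 1)) :=
    hPms (k + 1) (Nat.le_add_left 1 k)
  have hrate {ρ : ℝ} := exists_specNorm_sub_le_mul_pow (ρ := ρ) hm1 hmn hnN hA hB hgapn hgapm hP
    hPm hPs hPsIter hconv hPms'
  have hmono := eig_mono (hA.add hBh) hmn (hm1.trans hmn) hnN.le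
  have hβ0 : 0 ≤ specNorm B := norm_nonneg _
  have hpos : 0 < specNorm B + (eig (A + B) (n + 1) - eig (A + B) m) := by linarith
  refine ⟨?_, fun ρ hρ hρ1 => ?_⟩
  · obtain ⟨ρ, hρ, hρ1⟩ := exists_between ((div_lt_one hpos).2
      (show specNorm B < specNorm B + (eig (A + B) (n + 1) - eig (A + B) m) by linarith))
    have hρ0 : 0 ≤ ρ := (div_nonneg hβ0 hpos.le).trans hρ.le
    obtain ⟨C, -, hC⟩ := hrate hρ hρ1
    refine (Filter.tendsto_add_atTop_iff_nat 1).1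
      (squeeze_zero (fun k => norm_nonneg _) hC ?_)
    simpa using (tendsto_pow_atTop_nhds_zero_of_lt_one hρ0 hρ1).const_mul C
  · have hρ0 : 0 < ρ := (div_nonneg hβ0 hpos.le).trans_lt hρ
    by_cases h0 : Ps 0 = P
    · have hadd : A + B + (acomp B P - B) = A + acomp B P := by abel
      have hpsd := acomp_sub_self_posSemidef hB hP.1.1 hP.1.2.1
      have hWP := acomp_sub_self_mul hB hP.1.1 hP.1.2.1
      have hWPm : (acomp B P - B) * Pm = 0 := by
        rw [← hP.mul_eq_of_le (hA.add hBh) hmn (hm1.trans hmn) hnN hPm hgapn, ← mul_assoc, hWP,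
          zero_mul]
      have hconst (k : ℕ) : Ps k = P := by
        induction k with
        | zero => exact h0
        | succ k ih =>
          have h := hPsIter k
          rw [ih, ← hadd] at h
          exact hP.eq_of_mul_eq_zero (hA.add hBh) hpsd (hm1.trans hmn) hnN h hgapn hWP
      refine ⟨1, one_pos, fun k hk => ?_⟩
      have h := hPms k hk
      rw [hconst, ← hadd] at h
      rw [hPm.eq_of_mul_eq_zero (hA.add hBh) hpsd hm1 (by omega) h hgapm hWPm, h0]
      simp [specNorm_eq_norm]
    · obtain ⟨C, hC0, hC⟩ := hrate hρ hρ1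
      have hs : 0 < specNorm (Ps 0 - P) := by
        rw [specNorm_eq_norm, norm_pos_iff, map_ne_zero_iff _ (EquivLike.injective _)]
        exact sub_ne_zero.2 h0
      refine ⟨C / (ρ * specNorm (Ps 0 - P)), by positivity, fun k hk => ?_⟩
      obtain ⟨k, rfl⟩ := Nat.exists_eq_add_of_le' hk
      refine (hC k).trans_eq ?_
      field_simp
      exact (pow_succ ρ k).symm
end

section
/- Let B be an N×N Hermitian negative definite complex matrix, 1 ≤ n ≤ N, and let Q : ℝ → ℂ^{N×N} be a matrix-valued function, differentiable at a point t₀ ∈ ℝ, such that Q(t) is a rank-n orthogonal projector for every t in a neighborhood of t₀. Then the map t ↦ B̃[Q(t)] is differentiable at t₀, and its derivative equals M + M*, where M := (B − B̃[Q(t₀)]) · Q'(t₀) · B⁻¹ · B̃[Q(t₀)] and Q'(t₀) denotes the derivative of Q at t₀. -/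
open Matrix
open scoped ComplexOrder

attribute [local instance] Matrix.linftyOpNormedRing Matrix.linftyOpNormedAlgebra

/-- Entrywise differentiability of a matrix-valued curve is differentiability with respect to
the operator norm for the sup norm on vectors. -/
theorem hasDerivAt_matrix_iff {N : ℕ} {A : ℝ → Matrix (Fin N) (Fin N) ℂ}
    {A' : Matrix (Fin N) (Fin N) ℂ} {t : ℝ} :
    HasDerivAt A A' t ↔ ∀ i j, HasDerivAt (fun s => A s i j) (A' i j) t := by
  have h : HasDerivAt (fun s i j => A s i j) (fun i j => A' i j) t ↔
      ∀ i j, HasDerivAt (fun s => A s i j) (A' i j) t := by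
    simp only [hasDerivAt_pi]
  exact h

theorem HasDerivAt.matrix_inv {N : ℕ} {A : ℝ → Matrix (Fin N) (Fin N) ℂ}
    {A' : Matrix (Fin N) (Fin N) ℂ} {t : ℝ} (hA : HasDerivAt A A' t) (hu : IsUnit (A t)) :
    HasDerivAt (fun s => (A s)⁻¹) (-((A t)⁻¹ * A' * (A t)⁻¹)) t := by
  obtain ⟨u, hu⟩ := hu
  have h := hasFDerivAt_ringInverse (𝕜 := ℝ) u
  rw [hu] at h
  have h' := h.comp_hasDerivAt t hA
  rw [← hu, ← coe_units_inv]
  simp only [Matrix.nonsing_inv_eq_ringInverse]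
  exact h'

/-- The matrix `QBQ + (I - Q)` is invertible when `B` is negative definite and `Q` is an
orthogonal projector. -/
theorem isUnit_compression_add_compl {N : ℕ} {B Q : Matrix (Fin N) (Fin N) ℂ}
    (hB : (-B).PosDef) (hQ : Q.IsHermitian) (hQQ : Q * Q = Q) :
    IsUnit (Q * B * Q + (1 - Q)) := by
  rw [← Matrix.mulVec_injective_iff_isUnit]
  refine (injective_iff_map_eq_zero (Matrix.mulVecLin (Q * B * Q + (1 - Q)))).2 fun x hx => ?_
  rw [Matrix.mulVecLin_apply] at hx
  have hSP : (1 - Q) * (Q * B * Q + (1 - Q)) = 1 - Q := by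
    have h : (1 - Q) * Q = 0 := by rw [sub_mul, one_mul, hQQ, sub_self]
    rw [mul_add, ← mul_assoc, ← mul_assoc, h, mul_sub, h]
    simp
  have hPx : (1 - Q) *ᵥ x = 0 := by
    rw [← hSP, ← Matrix.mulVec_mulVec, hx, Matrix.mulVec_zero]
  have hQx : Q *ᵥ x = x := by
    rw [Matrix.sub_mulVec, Matrix.one_mulVec, sub_eq_zero] at hPx
    exact hPx.symm
  have hQBx : Q *ᵥ (B *ᵥ x) = 0 := by
    rw [Matrix.add_mulVec, hPx, add_zero, ← Matrix.mulVec_mulVec, hQx,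
      ← Matrix.mulVec_mulVec] at hx
    exact hx
  by_contra hne
  have hpos := hB.dotProduct_mulVec_pos hne
  have hstar : star x = star x ᵥ* Q := by
    conv_lhs => rw [← hQx, Matrix.star_mulVec, hQ.eq]
  rw [hstar, ← Matrix.dotProduct_mulVec, Matrix.neg_mulVec, Matrix.mulVec_neg, hQBx] at hpos
  simp at hpos

/-- The product-rule expression for the derivative of `(QBQ + (I - Q))⁻¹ - (I - Q)` along a curve
of idempotents, where `G` is the inverse and `D` the derivative of `Q`. -/
theorem derivative_compressed_inverse_eq {R : Type*} [Ring R] {B Q G D : R} (hQQ : Q * Q = Q)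
    (hSG : (Q * B * Q + (1 - Q)) * G = 1) (hGS : G * (Q * B * Q + (1 - Q)) = 1)
    (hD : D * Q + Q * D = D) :
    -(G * (D * B * Q + Q * B * D - D) * G) + D =
      (1 - (G - (1 - Q)) * B) * D * (G - (1 - Q)) +
        (G - (1 - Q)) * D * (1 - B * (G - (1 - Q))) := by
  have hPQ : (1 - Q) * Q = 0 := by rw [sub_mul, one_mul, hQQ, sub_self]
  have hQP : Q * (1 - Q) = 0 := by rw [mul_sub, mul_one, hQQ, sub_self]
  have hPP : (1 - Q) * (1 - Q) = 1 - Q := by rw [mul_sub, hPQ, mul_one, sub_zero]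
  have hGP : G * (1 - Q) = 1 - Q := by
    have h : (Q * B * Q + (1 - Q)) * (1 - Q) = 1 - Q := by
      rw [add_mul, mul_assoc, hQP, hPP, mul_zero, zero_add]
    calc G * (1 - Q) = G * ((Q * B * Q + (1 - Q)) * (1 - Q)) := by rw [h]
      _ = 1 - Q := by rw [← mul_assoc, hGS, one_mul]
  have hPG : (1 - Q) * G = 1 - Q := by
    have h : (1 - Q) * (Q * B * Q + (1 - Q)) = 1 - Q := by
      rw [mul_add, ← mul_assoc, ← mul_assoc, hPQ, hPP, zero_mul, zero_mul, zero_add]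
    calc (1 - Q) * G = (1 - Q) * (Q * B * Q + (1 - Q)) * G := by rw [h]
      _ = 1 - Q := by rw [mul_assoc, hSG, mul_one]
  obtain ⟨K, hK⟩ : ∃ K, K = G - (1 - Q) := ⟨_, rfl⟩
  have hG : G = K + (1 - Q) := by rw [hK]; abel
  have hQK : Q * K = K := by
    have h : (1 - Q) * K = 0 := by rw [hK, mul_sub, hPG, hPP, sub_self]
    rw [sub_mul, one_mul, sub_eq_zero] at h
    exact h.symm
  have hKQ : K * Q = K := by
    have h : K * (1 - Q) = 0 := by rw [hK, sub_mul, hGP, hPP, sub_self]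
    rw [mul_sub, mul_one, sub_eq_zero] at h
    exact h.symm
  have hQG : Q * G = K := by rw [hG, mul_add, hQP, hQK, add_zero]
  have hGQ : G * Q = K := by rw [hG, add_mul, hPQ, hKQ, add_zero]
  have hQBK : Q * B * K = Q := by
    rw [add_mul, mul_assoc, hQG, hPG] at hSG
    rw [eq_sub_of_add_eq hSG]; abel
  have hKBQ : K * B * Q = Q := by
    rw [mul_add, mul_assoc Q B Q, ← mul_assoc, hGQ, hGP, ← mul_assoc] at hGS
    rw [eq_sub_of_add_eq hGS]; abel
  have hPD : (1 - Q) * D = D * Q := by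
    rw [sub_mul, one_mul, sub_eq_iff_eq_add]; exact hD.symm
  have hDP : D * (1 - Q) = Q * D := by
    rw [mul_sub, mul_one, sub_eq_iff_eq_add, add_comm]; exact hD.symm
  have hGD : G * D = K * D + D * Q := by rw [hG, add_mul, hPD]
  have hDG : D * G = D * K + Q * D := by rw [hG, mul_add, hDP]
  have hQDK : Q * D * K = 0 := by
    have h : Q * D * Q = 0 := by
      have h' := congrArg (Q * ·) hD
      simpa [mul_add, ← mul_assoc, hQQ] using h'
    rw [← hQK, ← mul_assoc, h, zero_mul]
  have hKDK : K * D * K = 0 := by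
    rw [← hKQ, mul_assoc K Q D, mul_assoc, hKQ, hQDK, mul_zero]
  have hGDBQG : G * (D * B * Q) * G = K * D * B * K + D * Q := by
    calc G * (D * B * Q) * G = G * D * B * (Q * G) := by simp only [mul_assoc]
      _ = K * D * B * K + D * (Q * B * K) := by rw [hQG, hGD]; simp only [add_mul, mul_assoc]
      _ = _ := by rw [hQBK]
  have hGQBDG : G * (Q * B * D) * G = K * B * D * K + Q * D := by
    calc G * (Q * B * D) * G = G * Q * B * (D * G) := by simp only [mul_assoc]
      _ = K * B * D * K + K * B * Q * D := by rw [hGQ, hDG]; simp only [mul_add, mul_assoc]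
      _ = _ := by rw [hKBQ]
  have hGDG : G * D * G = K * D + D * K := by
    have hDQP : D * Q * (1 - Q) = 0 := by rw [mul_assoc, hQP, mul_zero]
    calc G * D * G = K * D * K + K * (D * (1 - Q)) + (D * (Q * K) + D * Q * (1 - Q)) := by
          rw [hGD, add_mul, hG]; simp only [mul_add, mul_assoc]
      _ = K * D + D * K := by
          rw [hKDK, hDP, hQK, hDQP, ← mul_assoc, hKQ, zero_add, add_zero]
  rw [← hK, mul_sub G, mul_add G, sub_mul, add_mul, hGDBQG, hGQBDG, hGDG]
  calc _ = D - (D * Q + Q * D) + (D * K - K * B * D * K + (K * D - K * D * B * K)) := by abel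
    _ = _ := by rw [hD, sub_self, zero_add]; noncomm_ring

/-- **Lemma `derivatives`.** If `Q(t)` is a curve of rank-`n` orthogonal projectors,
differentiable (entrywise) at `t₀` with derivative `Q'`, then `t ↦ B̃[Q(t)]` is
differentiable at `t₀` with derivative `M + M*` where
`M = (B − B̃[Q(t₀)]) Q' B⁻¹ B̃[Q(t₀)]`. -/
theorem acomp_derivative {N n : ℕ} (hn1 : 1 ≤ n) (hnN : n ≤ N)
    (B : Matrix (Fin N) (Fin N) ℂ) (hB : (-B).PosDef)
    (Q : ℝ → Matrix (Fin N) (Fin N) ℂ) (t₀ : ℝ)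
    (Q' : Matrix (Fin N) (Fin N) ℂ)
    (hQproj : ∀ᶠ t in nhds t₀, IsProjOfRank n (Q t))
    (hQdiff : ∀ i j : Fin N, HasDerivAt (fun t => Q t i j) (Q' i j) t₀) :
    ∀ i j : Fin N, HasDerivAt (fun t => acomp B (Q t) i j)
      (((B - acomp B (Q t₀)) * Q' * B⁻¹ * acomp B (Q t₀) +
        ((B - acomp B (Q t₀)) * Q' * B⁻¹ * acomp B (Q t₀))ᴴ) i j) t₀ := by
  rw [← hasDerivAt_matrix_iff] at hQdiff ⊢
  obtain ⟨hQ, hQQ, -⟩ := hQproj.self_of_nhds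
  have hBherm : Bᴴ = B := by simpa using hB.isHermitian.eq
  have hBu : IsUnit B := by simpa using hB.isUnit.neg
  have hBdet : IsUnit B.det := (Matrix.isUnit_iff_isUnit_det B).1 hBu
  have hQ'idem : Q' * Q t₀ + Q t₀ * Q' = Q' := by
    refine (hQdiff.mul hQdiff).unique (hQdiff.congr_of_eventuallyEq ?_)
    filter_upwards [hQproj] with t ht using ht.2.1
  have hQ'herm : Q'ᴴ = Q' := by
    have h : HasDerivAt (fun t => (Q t)ᴴ) Q'ᴴ t₀ :=
      hasDerivAt_matrix_iff.2 fun i j => (hasDerivAt_matrix_iff.1 hQdiff j i).star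
    refine h.unique (hQdiff.congr_of_eventuallyEq ?_)
    filter_upwards [hQproj] with t ht using ht.1.eq
  have hS := isUnit_compression_add_compl hB hQ hQQ
  have hSdet := (Matrix.isUnit_iff_isUnit_det _).1 hS
  have hP : HasDerivAt (fun t => 1 - Q t) (-Q') t₀ := hQdiff.const_sub 1
  have hSderiv : HasDerivAt (fun t => Q t * B * Q t + (1 - Q t))
      (Q' * B * Q t₀ + Q t₀ * B * Q' + -Q') t₀ :=
    ((hQdiff.mul_const B).mul hQdiff).add hP
  have hderiv := (((hSderiv.matrix_inv hS).const_mul B).mul_const B).sub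
    ((hP.const_mul B).mul_const B)
  have hkey := derivative_compressed_inverse_eq hQQ (Matrix.mul_nonsing_inv _ hSdet)
    (Matrix.nonsing_inv_mul _ hSdet) hQ'idem
  have hSherm : (Q t₀ * B * Q t₀ + (1 - Q t₀))ᴴ = Q t₀ * B * Q t₀ + (1 - Q t₀) := by
    simp [hQ.eq, hBherm, mul_assoc]
  have hGherm : ((Q t₀ * B * Q t₀ + (1 - Q t₀))⁻¹)ᴴ = (Q t₀ * B * Q t₀ + (1 - Q t₀))⁻¹ := by
    rw [Matrix.conjTranspose_nonsing_inv, hSherm]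
  refine HasDerivAt.congr_deriv (f := fun t => acomp B (Q t)) hderiv ?_
  generalize hG : (Q t₀ * B * Q t₀ + (1 - Q t₀))⁻¹ = G at hkey hGherm
  obtain ⟨K, hK⟩ : ∃ K, K = G - (1 - Q t₀) := ⟨_, rfl⟩
  have hKherm : Kᴴ = K := by simp [hK, hGherm, hQ.eq]
  have hX : acomp B (Q t₀) = B * K * B := by
    rw [acomp, hG, hK, mul_sub B G, sub_mul]
  have hM : (B - B * K * B) * Q' * B⁻¹ * (B * K * B) = B * ((1 - K * B) * Q' * K) * B := by
    have h : B⁻¹ * (B * K * B) = K * B := by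
      rw [mul_assoc B, Matrix.nonsing_inv_mul_cancel_left _ _ hBdet]
    rw [mul_assoc _ B⁻¹, h]
    noncomm_ring
  rw [hX, hM]
  simp only [Matrix.conjTranspose_mul, Matrix.conjTranspose_sub, Matrix.conjTranspose_one,
    hBherm, hKherm, hQ'herm]
  rw [← hK] at hkey
  calc _ = B * (-(G * (Q' * B * Q t₀ + Q t₀ * B * Q' - Q') * G) + Q') * B := by noncomm_ring
    _ = _ := by rw [hkey]; noncomm_ring
end
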